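/- Let F(X,Y) be a propositional CNF formula with quantified variables X and free variables Y, and let p be a Z-boundary point of F with Z ⊆ X. Then p is removable in ∃X.F if and only if one cannot turn p into a point satisfying F by changing only the values of variables of X. -/

import Mathlib

namespace QE

noncomputable section

attribute [local instance] Classical.propDecidable

/-- A literal: a variable together with a polarity. -/
structure Lit (V : Type) where
  var : V
  pos : Bool
deriving DecidableEq

variable {V : Type} [DecidableEq V]

/-- A clause is a (finite) disjunction of literals. -/
abbrev Clause (V : Type) := Finset (Lit V)

/-- A CNF formula is a (finite) set of clauses. -/
abbrev Cnf (V : Type) := Finset (Clause V)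

/-- The variables of a clause. -/
def Clause.vars (C : Clause V) : Finset V := C.image Lit.var

/-- The variables of a CNF formula. -/
def Cnf.vars (F : Cnf V) : Finset V := F.sup Clause.vars

/-- A total assignment (point) `t` satisfies the clause `C`. -/
def Clause.satAt (t : V → Bool) (C : Clause V) : Prop := ∃ l ∈ C, t l.var = l.pos

/-- A total assignment (point) `t` falsifies the clause `C`. -/
def Clause.falsAt (t : V → Bool) (C : Clause V) : Prop := ∀ l ∈ C, t l.var = !l.pos

/-- A total assignment (point) `t` satisfies the CNF formula `F`. -/
def Cnf.satAt (t : V → Bool) (F : Cnf V) : Prop := ∀ C ∈ F, Clause.satAt t C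

/-- A partial assignment: it assigns Boolean values to some of the variables. -/
abbrev PAssign (V : Type) := V → Option Bool

/-- The set of variables assigned in `q`. -/
def PAssign.dom (q : PAssign V) : Set V := {v | q v ≠ none}

/-- `q ⊆ r` for partial assignments (viewed as sets of value assignments). -/
def PAssign.le (q r : PAssign V) : Prop := ∀ v b, q v = some b → r v = some b

/-- `q ⊊ r` for partial assignments. -/
def PAssign.lt (q r : PAssign V) : Prop := PAssign.le q r ∧ q ≠ r

/-- The point (total assignment) `t` extends the partial assignment `q`. -/
def ExtendsPnt (t : V → Bool) (q : PAssign V) : Prop := ∀ v b, q v = some b → t v = b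

/-- Two partial assignments are compatible if every commonly assigned
variable gets the same value in both. -/
def PAssign.compatible (q r : PAssign V) : Prop :=
  ∀ v b b', q v = some b → r v = some b' → b = b'

/-- The union of two partial assignments. -/
def PAssign.union (q r : PAssign V) : PAssign V := fun v => (q v).orElse fun _ => r v

/-- The clause `C` is satisfied by the partial assignment `q`. -/
def Clause.satBy (q : PAssign V) (C : Clause V) : Prop := ∃ l ∈ C, q l.var = some l.pos

/-- The cofactor `C|_q` of an (unsatisfied) clause: remove the literals falsified by `q`. -/
def Clause.restrict (q : PAssign V) (C : Clause V) : Clause V :=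
  C.filter fun l => q l.var ≠ some (!l.pos)

/-- The cofactor `F|_q` of a CNF formula: drop the clauses satisfied by `q`
(they became `true`) and remove the falsified literals from the remaining clauses. -/
def Cnf.restrict (q : PAssign V) (F : Cnf V) : Cnf V :=
  (F.filter fun C => ¬ Clause.satBy q C).image (Clause.restrict q)

/-- The formula `∃X.F` evaluates to true at the point `t`. -/
def ExSat (X : Finset V) (F : Cnf V) (t : V → Bool) : Prop :=
  ∃ t' : V → Bool, (∀ v, v ∉ X → t' v = t v) ∧ Cnf.satAt t' F

/-- Equivalence `∃X.F ≡ ∃X.G`. -/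
def Eqv (X : Finset V) (F G : Cnf V) : Prop := ∀ t : V → Bool, ExSat X F t ↔ ExSat X G t

/-- The set `G` of clauses of `F` is redundant in `∃X.F`, i.e. `∃X.F ≡ ∃X.(F \ G)`. -/
def RedundantSet (X : Finset V) (F G : Cnf V) : Prop := Eqv X F (F \ G)

/-- The CNF formula `F` implies the clause `C`. -/
def CnfImplies (F : Cnf V) (C : Clause V) : Prop :=
  ∀ t : V → Bool, Cnf.satAt t F → Clause.satAt t C

/-- The CNF formula `F` implies the CNF formula `R`. -/
def CnfImpliesCnf (F R : Cnf V) : Prop :=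
  ∀ t : V → Bool, Cnf.satAt t F → Cnf.satAt t R

/-- `C` is a `Z`-clause, i.e. `Vars(C) ∩ Z ≠ ∅`. -/
def XClause (Z : Finset V) (C : Clause V) : Prop := (Clause.vars C ∩ Z).Nonempty

/-- The point `p` is a `Z`-boundary point of `F`. -/
def BoundaryPnt (F : Cnf V) (Z : Finset V) (p : V → Bool) : Prop :=
  Z.Nonempty ∧ Z ⊆ Cnf.vars F ∧ ¬ Cnf.satAt p F ∧
  (∀ C ∈ F, Clause.falsAt p C → XClause Z C) ∧
  ∀ Z' ⊂ Z, ¬ ∀ C ∈ F, Clause.falsAt p C → XClause Z' C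

/-- The point `p` is `X'`-removable in `F`: there is a clause `C` implied by `F`,
with no variable in `X'`, falsified by `p`. -/
def Removable (F : Cnf V) (X' : Finset V) (p : V → Bool) : Prop :=
  ∃ C : Clause V, CnfImplies F C ∧ Clause.vars C ∩ X' = ∅ ∧ Clause.falsAt p C

/-- `q*`: remove from `q` all value assignments to variables of `X`. -/
def stripX (X : Finset V) (q : PAssign V) : PAssign V := fun v => if v ∈ X then none else q v

/-- The clause `C|_q` is virtually redundant in `∃X.(F|_q)`: for every point `p`
such that the only clause of `F|_q` falsified by `p` is `C|_q` and `p` is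
`X`-removable in `F|_q`, there is an assignment `r` with `q* ⊆ r ⊊ q` such that
`p` is not `X`-removable in `F|_r`.  (If the set of such points `p` is empty
this holds vacuously, which is exactly regular redundancy.) -/
def VirtRed (X : Finset V) (F : Cnf V) (q : PAssign V) (C : Clause V) : Prop :=
  ∀ p : V → Bool,
    Clause.falsAt p (Clause.restrict q C) →
    (∀ D ∈ Cnf.restrict q F, Clause.falsAt p D → D = Clause.restrict q C) →
    Removable (Cnf.restrict q F) X p →
    ∃ r : PAssign V, PAssign.le (stripX X q) r ∧ PAssign.lt r q ∧
      ¬ Removable (Cnf.restrict r F) X p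

/-- The D-sequent `(∃X.F, q, H) → C` holds: for every member formula `W` with
`H ∪ {C} ⊆ W ⊆ F` such that `∃X.(W|_q) ≡ ∃X.(F|_q)`, the clause `C|_q` is
(at least virtually) redundant in `∃X.(W|_q)`. -/
def IsDseq (X : Finset V) (F : Cnf V) (q : PAssign V) (H : Cnf V) (C : Clause V) : Prop :=
  ∀ W : Cnf V, H ∪ {C} ⊆ W → W ⊆ F →
    Eqv X (Cnf.restrict q W) (Cnf.restrict q F) → VirtRed X W q C

/-- Consistency of the set of D-sequents `(q^i, H_i) → C_i`, `i = 1,…,k`: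
the conditionals are pairwise compatible and there is a total order `π` on the
clauses of `⋃ᵢ (H_i ∪ {C_i})` satisfying the order constraints. -/
def Consistent {k : ℕ} (qs : Fin k → PAssign V) (Hs : Fin k → Cnf V)
    (Cs : Fin k → Clause V) : Prop :=
  (∀ i j, PAssign.compatible (qs i) (qs j)) ∧
  ∃ π : Clause V → ℕ,
    Set.InjOn π (⋃ i, ((Hs i ∪ {Cs i} : Cnf V) : Set (Clause V))) ∧
    ∀ i, ∀ D ∈ Hs i, π (Cs i) < π D

/-- Clauses `C` and `D` are resolvable on `v`: they have opposite literals of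
exactly one variable, namely `v`. -/
def ClResolvable (C D : Clause V) (v : V) : Prop :=
  (∃ b : Bool, (⟨v, b⟩ : Lit V) ∈ C ∧ (⟨v, !b⟩ : Lit V) ∈ D) ∧
  ∀ u, u ≠ v → ∀ b : Bool, (⟨u, b⟩ : Lit V) ∈ C → (⟨u, !b⟩ : Lit V) ∉ D

/-- The clause `C` is blocked at variable `v` in the CNF formula `G`. -/
def Blocked (G : Cnf V) (C : Clause V) (v : V) : Prop := ∀ D ∈ G, ¬ ClResolvable C D v

/-- Assignments `q` and `r` are resolvable on `v`: exactly one commonly assigned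
variable, namely `v`, is assigned different values. -/
def PResolvable (q r : PAssign V) (v : V) : Prop :=
  (∃ b : Bool, q v = some b ∧ r v = some (!b)) ∧
  ∀ u, u ≠ v → ∀ b b' : Bool, q u = some b → r u = some b' → b = b'

/-- The resolvent of assignments `q` and `r` on `v`: all value assignments of
`q` and `r` except those to `v`. -/
def PResolvent (q r : PAssign V) (v : V) : PAssign V :=
  fun u => if u = v then none else (q u).orElse fun _ => r u

/-- A `Z`-boundary point `p` of `F(X,Y)` with `Z ⊆ X` is removable in
`∃X.F` iff one cannot turn `p` into a point satisfying `F` by changing only the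
values of variables of `X`. -/
theorem removable_iff_no_X_flip_satisfies
    (X Y : Finset V) (F : Cnf V) (hXY : Disjoint X Y) (hFvars : Cnf.vars F ⊆ X ∪ Y)
    (Z : Finset V) (hZX : Z ⊆ X) (p : V → Bool) (hbnd : BoundaryPnt F Z p) :
    Removable F X p ↔
      ¬ ∃ p' : V → Bool, (∀ v, v ∉ X → p' v = p v) ∧ Cnf.satAt p' F := by
  constructor
  · rintro ⟨C, hC, hdis, hf⟩ ⟨p', hp', hsat⟩
    obtain ⟨l, hl, hlt⟩ := hC p' hsat
    have hv : l.var ∈ Clause.vars C := Finset.mem_image_of_mem _ hl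
    have hnX : l.var ∉ X := by
      intro hx
      have hmem : l.var ∈ Clause.vars C ∩ X := Finset.mem_inter.mpr ⟨hv, hx⟩
      rw [hdis] at hmem
      exact Finset.notMem_empty _ hmem
    have h1 := hf l hl
    rw [← hp' _ hnX, hlt] at h1
    cases hb : l.pos <;> simp [hb] at h1
  · intro hno
    refine ⟨Y.image (fun y => (⟨y, !(p y)⟩ : Lit V)), ?_, ?_, ?_⟩
    · intro t ht
      by_contra hcon
      have hag : ∀ y ∈ Y, t y = p y := by
        intro y hy
        by_contra hne
        refine hcon ⟨⟨y, !(p y)⟩, Finset.mem_image.mpr ⟨y, hy, rfl⟩, ?_⟩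
        show t y = !(p y)
        cases h1 : t y <;> cases h2 : p y <;> simp_all
      refine hno ⟨fun v => if v ∈ X then t v else p v, ?_, ?_⟩
      · intro v hv
        simp [hv]
      · intro C hC
        obtain ⟨l, hl, hlt⟩ := ht C hC
        refine ⟨l, hl, ?_⟩
        have hv : l.var ∈ Cnf.vars F :=
          (Finset.le_sup (f := Clause.vars) hC) (Finset.mem_image_of_mem _ hl)
        by_cases hx : l.var ∈ X
        · simp [hx, hlt]
        · have hy : l.var ∈ Y := (Finset.mem_union.mp (hFvars hv)).resolve_left hx
          simp [hx, ← hag _ hy, hlt]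
    · apply Finset.eq_empty_of_forall_notMem
      intro v hv
      obtain ⟨h1, h2⟩ := Finset.mem_inter.mp hv
      obtain ⟨l, hl, rfl⟩ := Finset.mem_image.mp h1
      obtain ⟨y, hy, rfl⟩ := Finset.mem_image.mp hl
      exact Finset.disjoint_left.mp hXY h2 hy
    · intro l hl
      obtain ⟨y, hy, rfl⟩ := Finset.mem_image.mp hl
      simp

end

end QE
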